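/- In the abstract lake-kernel setup with δ(ε) := 1/ln(1/ε), suppose in addition: φ := (κ₀/(4π))·b + q attains its maximum over cl(D) at a point x̂ ∈ D; there are r ∈ (0, dist(x̂,∂D)) and C₀ ≥ 0 such that G(x,y) ≥ (1/(2π))·ln(1/|x−y|) − C₀ for a.e. x,y ∈ B_r(x̂); and b and q are Lipschitz continuous on B_r(x̂). Let f satisfy (H1) with lim_{s→∞} f(s) = +∞, κ₀ > 0, Λ ≥ 1. Then there exist C > 0 and ε₀ ∈ (0, 1/e) such that for every ε ∈ (0,ε₀): sup_{ζ ∈ A_{ε,Λ}} E(ζ) ≥ φ(x̂)·κ₀·δ(ε) − C·( f⁻¹(δ(ε)) + ln ln(1/ε)/ln(1/ε) )·δ(ε). -/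

import Mathlib

open MeasureTheory Metric Real Set Filter

noncomputable section

abbrev Pt : Type := EuclideanSpace ℝ (Fin 2)

/-- The operator `K` of the abstract lake-kernel setup:
`Kζ(x) = b(x)∫_D G(x,y)ζ(y) dν(y) + ∫_D R(x,y)ζ(y) dν(y)`, where `dν = b dm`. -/
def Kop (D : Set Pt) (b : Pt → ℝ) (G R : Pt → Pt → ℝ) (ζ : Pt → ℝ) (x : Pt) : ℝ :=
  b x * (∫ y in D, G x y * ζ y * b y) + ∫ y in D, R x y * ζ y * b y

/-- `F_*(s) = ∫₀^s f⁻¹(r) dr`. -/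
def Fstar (finv : ℝ → ℝ) (s : ℝ) : ℝ := ∫ r in (0:ℝ)..s, finv r

/-- The admissible class `A_{ε,Λ}`:
`0 ≤ ζ ≤ Λδ(ε)/ε²` a.e. in `D` and `∫_D ζ dν = κ₀ δ(ε)`. -/
def InA (D : Set Pt) (b : Pt → ℝ) (κ₀ ε δ Λ : ℝ) (ζ : Pt → ℝ) : Prop :=
  Measurable ζ ∧ (∀ᵐ x ∂(volume.restrict D), 0 ≤ ζ x ∧ ζ x ≤ Λ * δ / ε ^ 2) ∧
    (∫ x in D, ζ x * b x) = κ₀ * δ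

/-- The energy functional
`E(ζ) = (1/2)∫_D ζ·Kζ dν + ∫_D qζ dν − (δ/ε²)∫_D F_*((ε²/δ)ζ) dν`. -/
def Efun (D : Set Pt) (b q : Pt → ℝ) (G R : Pt → Pt → ℝ) (finv : ℝ → ℝ)
    (ε δ : ℝ) (ζ : Pt → ℝ) : ℝ :=
  (1/2) * (∫ x in D, ζ x * Kop D b G R ζ x * b x)
    + (∫ x in D, q x * ζ x * b x)
    - (δ / ε ^ 2) * ∫ x in D, Fstar finv ((ε ^ 2 / δ) * ζ x) * b x


lemma aux_inv_norm (S : ℝ) :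
    Integrable ((ball (0:Pt) S).indicator (fun z : Pt => ‖z‖⁻¹)) volume := by
  have h := (integrable_fun_norm_addHaar (volume : Measure Pt)
    (f := (Iio S).indicator (fun y : ℝ => y⁻¹))).2 ?_
  · refine h.congr (Eventually.of_forall fun z => ?_)
    by_cases hz : ‖z‖ < S <;> simp [indicator, hz]
  · have h1 : IntegrableOn (fun _ : ℝ => (1:ℝ)) (Ioo 0 S) := by
      apply integrableOn_const <;> simp
    have h2 : IntegrableOn ((Ioo 0 S).indicator (fun _ : ℝ => (1:ℝ))) (Ioi 0) :=
      ((integrable_indicator_iff measurableSet_Ioo).2 h1).integrableOn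
    refine h2.congr_fun (fun y hy => ?_) measurableSet_Ioi
    have hy0 : (0:ℝ) < y := hy
    by_cases hz : y < S <;> simp [indicator, hz, hy0, hy0.ne']

lemma aux_inv_dist (D : Set Pt) (hDm : MeasurableSet D) (hDb : Bornology.IsBounded D) :
    Integrable (fun p : Pt × Pt => (dist p.1 p.2)⁻¹)
      ((volume.restrict D).prod (volume.restrict D)) := by
  have h1 : Integrable (D.indicator (fun _ : Pt => (1:ℝ))) volume :=
    (integrable_indicator_iff hDm).2 (integrableOn_const hDb.measure_lt_top.ne)
  have h2 := aux_inv_norm (diam D + 1)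
  have h3 := h1.convolution_integrand (ContinuousLinearMap.mul ℝ ℝ) h2
  rw [Measure.prod_restrict]
  refine IntegrableOn.congr_fun h3.integrableOn (fun p hp => ?_) (hDm.prod hDm)
  have hd : ‖p.1 - p.2‖ < diam D + 1 := by
    rw [← dist_eq_norm]
    have := dist_le_diam_of_mem hDb hp.1 hp.2
    linarith
  simp [indicator, hp.2, hd, dist_eq_norm]

lemma aux_offdiag (D : Set Pt) :
    ∀ᵐ p ∂((volume.restrict D).prod (volume.restrict D)), p.1 ≠ (p.2 : Pt) := by
  rw [Measure.ae_prod_iff_ae_ae]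
  · refine Eventually.of_forall fun x => ?_
    refine ae_restrict_of_ae ?_
    have : ∀ᵐ y ∂(volume : Measure Pt), y ≠ x := by
      simp [ae_iff]
    filter_upwards [this] with y hy using hy.symm
  · exact (measurableSet_eq_fun measurable_fst measurable_snd).compl

lemma aux_G (D : Set Pt) (hDm : MeasurableSet D) (hDb : Bornology.IsBounded D)
    (G : Pt → Pt → ℝ) (hGm : Measurable (Function.uncurry G))
    (hGbd : ∀ᵐ p ∂((volume.restrict D).prod (volume.restrict D)),
      0 ≤ G p.1 p.2 ∧ G p.1 p.2 ≤ (1 / (2 * π)) * log (diam D / dist p.1 p.2)) :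
    Integrable (fun p : Pt × Pt => G p.1 p.2)
      ((volume.restrict D).prod (volume.restrict D)) := by
  refine ((aux_inv_dist D hDm hDb).const_mul ((1 / (2 * π)) * diam D)).mono'
    hGm.aestronglyMeasurable ?_
  filter_upwards [hGbd, aux_offdiag D] with p hp _
  rw [norm_eq_abs, abs_of_nonneg hp.1]
  refine hp.2.trans ?_
  rw [mul_assoc]
  refine mul_le_mul_of_nonneg_left ?_ (by positivity)
  rw [← div_eq_mul_inv]
  exact log_le_self (div_nonneg diam_nonneg dist_nonneg)

lemma aux_energy (μ : Measure Pt) [IsFiniteMeasure μ] (b : Pt → ℝ) (hbm : AEStronglyMeasurable b μ)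
    (Cb : ℝ) (hCb : ∀ᵐ x ∂μ, ‖b x‖ ≤ Cb)
    (G : Pt → Pt → ℝ) (hG : Integrable (fun p : Pt × Pt => G p.1 p.2) (μ.prod μ))
    (R : Pt → Pt → ℝ) (hR : Integrable (fun p : Pt × Pt => R p.1 p.2) (μ.prod μ))
    (ζ : Pt → ℝ) (hζm : Measurable ζ) (Cz : ℝ) (hCz : ∀ x, ‖ζ x‖ ≤ Cz) (A : ℝ)
    (hA : ∀ᵐ p ∂(μ.prod μ), A * ((ζ p.1 * b p.1) * (ζ p.2 * b p.2)) ≤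
      (b p.1 * G p.1 p.2 + R p.1 p.2) * ((ζ p.1 * b p.1) * (ζ p.2 * b p.2))) :
    A * (∫ x, ζ x * b x ∂μ) ^ 2 ≤
      ∫ x, ζ x * (b x * (∫ y, G x y * ζ y * b y ∂μ) + ∫ y, R x y * ζ y * b y ∂μ) * b x ∂μ := by
  have hCb2 : ∀ᵐ p ∂(μ.prod μ), ‖b p.2‖ ≤ Cb :=
    Measure.quasiMeasurePreserving_snd.ae hCb
  have hCb1 : ∀ᵐ p ∂(μ.prod μ), ‖b p.1‖ ≤ Cb :=
    Measure.quasiMeasurePreserving_fst.ae hCb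
  have hbm1 : AEStronglyMeasurable (fun p : Pt × Pt => b p.1) (μ.prod μ) := hbm.comp_fst
  have hbm2 : AEStronglyMeasurable (fun p : Pt × Pt => b p.2) (μ.prod μ) := hbm.comp_snd
  have hz1 : AEStronglyMeasurable (fun p : Pt × Pt => ζ p.1) (μ.prod μ) :=
    (hζm.comp measurable_fst).aestronglyMeasurable
  have hz2 : AEStronglyMeasurable (fun p : Pt × Pt => ζ p.2) (μ.prod μ) :=
    (hζm.comp measurable_snd).aestronglyMeasurable
  have key : ∀ H : Pt → Pt → ℝ, Integrable (fun p : Pt × Pt => H p.1 p.2) (μ.prod μ) →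
      Integrable (fun p : Pt × Pt => H p.1 p.2 * ζ p.2 * b p.2) (μ.prod μ) := by
    intro H hH
    exact (hH.mul_bdd (c := Cz) hz2 (Eventually.of_forall fun p => hCz _)).mul_bdd (c := Cb) hbm2 hCb2
  have iG := key G hG
  have iR := key R hR
  have iT : Integrable (fun p : Pt × Pt =>
      (b p.1 * G p.1 p.2 + R p.1 p.2) * ((ζ p.1 * b p.1) * (ζ p.2 * b p.2))) (μ.prod μ) := by
    have h1 := ((iG.bdd_mul (c := Cb) hbm1 hCb1).add iR).mul_bdd (c := Cz) hz1
      (Eventually.of_forall fun p => hCz _)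
    have h2 := h1.mul_bdd (c := Cb) hbm1 hCb1
    refine h2.congr (Eventually.of_forall fun p => ?_)
    simp only [Pi.add_apply]
    ring
  have iw : Integrable (fun x => ζ x * b x) μ := by
    have := (integrable_const (μ := μ) (1:ℝ)).mul_bdd (c := Cz) hζm.aestronglyMeasurable
      (Eventually.of_forall fun p => hCz _)
    simpa using this.mul_bdd (c := Cb) hbm hCb
  have e1 : ∫ x, ζ x * (b x * (∫ y, G x y * ζ y * b y ∂μ) + ∫ y, R x y * ζ y * b y ∂μ) * b x ∂μ
      = ∫ p, (b p.1 * G p.1 p.2 + R p.1 p.2) * ((ζ p.1 * b p.1) * (ζ p.2 * b p.2)) ∂(μ.prod μ) := by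
    rw [integral_prod _ iT]
    refine integral_congr_ae ?_
    filter_upwards [iG.prod_right_ae, iR.prod_right_ae] with x hx1 hx2
    rw [← integral_const_mul, ← integral_add (hx1.const_mul _) hx2, ← integral_const_mul,
      ← integral_mul_const]
    refine integral_congr_ae (Eventually.of_forall fun y => ?_)
    simp only
    ring
  rw [e1, sq, ← integral_prod_mul (μ := μ) (ν := μ) (fun x => ζ x * b x) (fun x => ζ x * b x),
    ← integral_const_mul]
  exact integral_mono_ae ((iw.mul_prod iw).const_mul _) iT hA

lemma aux_finv (f : ℝ → ℝ) (f0 : ℝ) (hfneg : ∀ s ≤ (0:ℝ), f s = 0)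
    (hfmono : StrictMonoOn f (Ici (0:ℝ))) (hf0n : 0 ≤ f0)
    (finv : ℝ → ℝ) (hfinv0 : ∀ s ≤ f0, finv s = 0)
    (hfinvr : ∀ t ≥ f0, f (finv t) = t) : Monotone finv ∧ ∀ t, 0 ≤ finv t := by
  have hn : ∀ t, 0 ≤ finv t := by
    intro t
    rcases le_or_gt t f0 with h | h
    · rw [hfinv0 t h]
    · by_contra! hc
      have h1 := hfinvr t h.le
      rw [hfneg _ hc.le] at h1
      linarith
  refine ⟨?_, hn⟩
  intro s t hst
  rcases le_or_gt s f0 with h | h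
  · rw [hfinv0 s h]; exact hn t
  · by_contra! hc
    have := hfmono (hn t) (hn s) hc
    rw [hfinvr s h.le, hfinvr t (h.le.trans hst)] at this
    linarith

lemma aux_Fstar (finv : ℝ → ℝ) (hm : Monotone finv) (s d : ℝ) (hs : 0 ≤ s) (hsd : s ≤ d) :
    ∫ r in (0:ℝ)..s, finv r ≤ s * finv d := by
  have : ∫ r in (0:ℝ)..s, finv r ≤ ∫ r in (0:ℝ)..s, finv d := by
    refine intervalIntegral.integral_mono_on hs hm.intervalIntegrable (by simp) ?_
    intro x hx
    exact hm (hx.2.trans hsd)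
  simpa using this

lemma aux_L (r' Lb b0 C₀ κ : ℝ) (hr' : 0 < r') (hb0 : 0 < b0) :
    ∃ L0 : ℝ, 2 ≤ L0 ∧ ∀ L > L0, 1 ≤ log L ∧ exp (-L) * L * L ≤ 1 ∧ 1 / L < r' ∧
      Lb * (1 / L) ≤ b0 ∧ κ ≤ b0 * π * L ∧
      0 ≤ (1 / (2 * π)) * (L - log 2 - log L) - C₀ := by
  have t1 : ∀ᶠ L : ℝ in atTop, 1 ≤ log L := tendsto_log_atTop.eventually_ge_atTop 1
  have t2 : ∀ᶠ L : ℝ in atTop, exp (-L) * L * L ≤ 1 := by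
    have := (tendsto_pow_mul_exp_neg_atTop_nhds_zero 2).eventually_le_const (u := 1) (by norm_num)
    filter_upwards [this] with L hL
    nlinarith
  have ti : Tendsto (fun L : ℝ => 1 / L) atTop (nhds 0) := by
    simpa using tendsto_inv_atTop_zero (𝕜 := ℝ)
  have t3 : ∀ᶠ L : ℝ in atTop, 1 / L < r' := ti.eventually_lt_const hr'
  have t4 : ∀ᶠ L : ℝ in atTop, Lb * (1 / L) ≤ b0 :=
    (by simpa using ti.const_mul Lb : Tendsto (fun L : ℝ => Lb * (1 / L)) atTop (nhds 0)).eventually_le_const hb0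
  have t5 : ∀ᶠ L : ℝ in atTop, κ ≤ b0 * π * L :=
    (tendsto_id.const_mul_atTop (by positivity : 0 < b0 * π)).eventually_ge_atTop κ
  have t6 : ∀ᶠ L : ℝ in atTop, 0 ≤ (1 / (2 * π)) * (L - log 2 - log L) - C₀ := by
    have h1 : ∀ᶠ L : ℝ in atTop, ‖log L‖ ≤ (1/2) * ‖L‖ :=
      isLittleO_log_id_atTop.bound (by norm_num)
    filter_upwards [h1, eventually_ge_atTop (2 * (log 2 + 2 * π * C₀)), eventually_ge_atTop 0]
      with L h1 h2 h3
    rw [norm_eq_abs, norm_eq_abs, abs_of_nonneg h3] at h1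
    have h4 := le_abs_self (log L)
    have h5 : 2 * π * C₀ ≤ L - log 2 - log L := by linarith
    have h6 : C₀ = (1 / (2 * π)) * (2 * π * C₀) := by field_simp
    have h7 := mul_le_mul_of_nonneg_left h5 (by positivity : 0 ≤ 1 / (2 * π))
    linarith
  obtain ⟨L0, hL0⟩ := eventually_atTop.1 (t1.and (t2.and (t3.and (t4.and (t5.and t6)))))
  exact ⟨max L0 2, le_max_right _ _, fun L hL => hL0 L ((le_max_left _ _).trans hL.le)⟩

lemma aux_arith (κ b q Lb Lq ρ A2 CR δ L l C₀ v : ℝ) (hκ : 0 < κ) (hb : 0 < b) (hLb : 0 ≤ Lb)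
    (hLq : 0 ≤ Lq) (hρ : 0 ≤ ρ) (hρL : ρ * L ≤ 1) (hδ : 0 < δ) (hδL : δ * L = 1) (hL : 0 < L)
    (hl : 1 ≤ l) (hC : 0 ≤ C₀) (hCR : 0 ≤ CR) (hv : 0 ≤ v) (hA0 : 0 ≤ A2)
    (hA : A2 = (1 / (2 * π)) * (L - log 2 - l) - C₀) :
    ((κ / (4 * π)) * b + q) * κ * δ
      - (κ + κ ^ 2 / 2 * (2 * b + b * C₀ + Lb + CR) + Lq * κ) * (v + l * δ) * δ ≤
    (1 / 2) * (((b - Lb * ρ) * A2 - CR) * (κ * δ) ^ 2)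
      + (q - Lq * ρ) * (κ * δ) - κ * δ * v := by
  have hi0 : 0 ≤ 1 / (2 * π) := by positivity
  have hi1 : 1 / (2 * π) ≤ 1 := by
    rw [div_le_one (by positivity)]; linarith [pi_gt_three]
  have hlog2 : log 2 ≤ 1 := by linarith [log_two_lt_d9]
  have hlog0 : 0 ≤ log 2 := log_nonneg (by norm_num)
  have hA2L : A2 ≤ L := by
    have : (1 / (2 * π)) * (L - log 2 - l) ≤ (1 / (2 * π)) * L :=
      mul_le_mul_of_nonneg_left (by linarith) hi0
    nlinarith
  have hρA : ρ * A2 ≤ l := by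
    have := mul_le_mul_of_nonneg_left hA2L hρ
    linarith
  have hAlow : (1 / (2 * π)) * L - 2 * l - C₀ * l ≤ A2 := by
    have h1 : (1 / (2 * π)) * (log 2 + l) ≤ 2 * l := by nlinarith
    have h2 : C₀ ≤ C₀ * l := by nlinarith
    rw [hA]; linarith
  have hρδ : ρ ≤ l * δ := by
    have h1 : ρ = ρ * L * δ := by rw [mul_assoc, mul_comm L, hδL, mul_one]
    rw [h1]; nlinarith
  have hmain : b * ((1 / (2 * π)) * L) - (2 * b + b * C₀ + Lb + CR) * l ≤
      (b - Lb * ρ) * A2 - CR := by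
    have h1 := mul_le_mul_of_nonneg_left hAlow hb.le
    have h2 := mul_le_mul_of_nonneg_left hρA hLb
    have h3 : CR ≤ CR * l := by nlinarith
    linarith
  have h4 := mul_le_mul_of_nonneg_right hmain (by positivity : 0 ≤ (κ * δ) ^ 2)
  have h5 : b * ((1 / (2 * π)) * L) * (κ * δ) ^ 2 = 2 * ((κ / (4 * π)) * b * κ * δ) * (δ * L) := by
    field_simp
    ring
  rw [hδL] at h5
  have h6 := mul_le_mul_of_nonneg_left hρδ (by positivity : 0 ≤ Lq * (κ * δ))
  have h7 : 0 ≤ (κ ^ 2 / 2 * (2 * b + b * C₀ + Lb + CR) + Lq * κ) * v * δ := by positivity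
  have h8 : 0 ≤ κ * (l * δ) * δ := by positivity
  linarith

set_option maxHeartbeats 1000000 in
/-- Lower bound (4-8) of Lemma 4.3, at the critical rate `δ(ε) = 1/ln(1/ε)`:
if `φ = (κ₀/(4π)) b + q` attains its maximum over `cl(D)` at `x̂ ∈ D`, near
which `G` has the logarithmic lower bound and `b, q` are Lipschitz, then
`sup_{A_{ε,Λ}} E ≥ φ(x̂) κ₀ δ(ε) − C (f⁻¹(δ(ε)) + ln ln(1/ε)/ln(1/ε)) δ(ε)`
for all small `ε`. -/
theorem stmt16
    -- the domain
    (D : Set Pt) (hDo : IsOpen D) (hDne : D.Nonempty) (hDbdd : Bornology.IsBounded D)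
    -- the depth function
    (b : Pt → ℝ) (hb : ContinuousOn b (closure D)) (hbpos : ∀ x ∈ D, 0 < b x)
    -- the background stream function
    (q : Pt → ℝ) (hq : ContinuousOn q (closure D))
    -- the kernel G
    (G : Pt → Pt → ℝ) (hGm : Measurable (Function.uncurry G))
    (hGsymm : ∀ x y, G x y = G y x)
    (hGbd : ∀ᵐ p ∂((volume.restrict D).prod (volume.restrict D)),
      0 ≤ G p.1 p.2 ∧ G p.1 p.2 ≤ (1 / (2 * π)) * log (diam D / dist p.1 p.2))
    -- the correction kernel R
    (R : Pt → Pt → ℝ) (hRm : Measurable (Function.uncurry R))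
    (hRsymm : ∀ x y, R x y = R y x) (CR : ℝ) (hCR : ∀ x y, |R x y| ≤ CR)
    -- the nonlinearity f satisfying (H1) with f → ∞ at ∞, and its inverse finv
    (f : ℝ → ℝ) (f0 : ℝ)
    (hfc : ContinuousOn f ({(0:ℝ)}ᶜ)) (hfneg : ∀ s ≤ (0:ℝ), f s = 0)
    (hfmono : StrictMonoOn f (Ici (0:ℝ)))
    (hf0 : Tendsto f (nhdsWithin 0 (Ioi 0)) (nhds f0)) (hf0n : 0 ≤ f0)
    (hfinf : Tendsto f atTop atTop)
    (finv : ℝ → ℝ) (hfinv0 : ∀ s ≤ f0, finv s = 0)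
    (hfinvl : ∀ s ≥ (0:ℝ), finv (f s) = s) (hfinvr : ∀ t ≥ f0, f (finv t) = t)
    -- the parameters
    (κ₀ Λ : ℝ) (hκ : 0 < κ₀) (hΛ : 1 ≤ Λ)
    -- interior maximum point of φ = (κ₀/(4π)) b + q
    (xhat : Pt) (hxhatD : xhat ∈ D)
    (hxhatmax : ∀ x ∈ closure D,
      (κ₀ / (4 * π)) * b x + q x ≤ (κ₀ / (4 * π)) * b xhat + q xhat)
    -- local lower bound on G and local Lipschitz continuity of b and q near x̂
    (r : ℝ) (hr : 0 < r) (hr2 : r < infDist xhat (frontier D))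
    (C₀ : ℝ) (hC₀ : 0 ≤ C₀)
    (hGlow : ∀ᵐ p ∂((volume.restrict (ball xhat r)).prod (volume.restrict (ball xhat r))),
      (1 / (2 * π)) * log (1 / dist p.1 p.2) - C₀ ≤ G p.1 p.2)
    (Lb Lq : NNReal) (hblip : LipschitzOnWith Lb b (ball xhat r))
    (hqlip : LipschitzOnWith Lq q (ball xhat r)) :
    ∃ C > (0:ℝ), ∃ ε₀ ∈ Ioo (0:ℝ) (exp (-1)), ∀ ε ∈ Ioo (0:ℝ) ε₀,
      ∃ ζ : Pt → ℝ, InA D b κ₀ ε (1 / log (1 / ε)) Λ ζ ∧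
        ((κ₀ / (4 * π)) * b xhat + q xhat) * κ₀ * (1 / log (1 / ε))
            - C * (finv (1 / log (1 / ε)) + log (log (1 / ε)) / log (1 / ε))
                * (1 / log (1 / ε)) ≤
          Efun D b q G R finv ε (1 / log (1 / ε)) ζ := by
  classical
  have hDm : MeasurableSet D := hDo.measurableSet
  have : IsFiniteMeasure (volume.restrict D) := ⟨by
    rw [Measure.restrict_apply_univ]; exact hDbdd.measure_lt_top⟩
  have hcomp : IsCompact (closure D) := hDbdd.isCompact_closure
  obtain ⟨Cb, hCb⟩ := hcomp.exists_bound_of_continuousOn hb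
  obtain ⟨Cq, hCq⟩ := hcomp.exists_bound_of_continuousOn hq
  have hCb' : ∀ᵐ x ∂(volume.restrict D), ‖b x‖ ≤ Cb :=
    (ae_restrict_iff' hDm).2 (Eventually.of_forall fun x hx => hCb x (subset_closure hx))
  have hCq' : ∀ᵐ x ∂(volume.restrict D), ‖q x‖ ≤ Cq :=
    (ae_restrict_iff' hDm).2 (Eventually.of_forall fun x hx => hCq x (subset_closure hx))
  have hbm : AEStronglyMeasurable b (volume.restrict D) :=
    (hb.mono subset_closure).aestronglyMeasurable hDm
  have hqm : AEStronglyMeasurable q (volume.restrict D) :=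
    (hq.mono subset_closure).aestronglyMeasurable hDm
  have hGi := aux_G D hDm hDbdd G hGm hGbd
  have hRi : Integrable (fun p : Pt × Pt => R p.1 p.2)
      ((volume.restrict D).prod (volume.restrict D)) :=
    (integrable_const CR).mono' hRm.aestronglyMeasurable
      (Eventually.of_forall fun p => hCR p.1 p.2)
  obtain ⟨hfim, hfin⟩ := aux_finv f f0 hfneg hfmono hf0n finv hfinv0 hfinvr
  obtain ⟨r1, hr1, hr1D⟩ := Metric.isOpen_iff.1 hDo xhat hxhatD
  have hbh : 0 < b xhat := hbpos xhat hxhatD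
  have hCR0 : 0 ≤ CR := (abs_nonneg _).trans (hCR xhat xhat)
  obtain ⟨L0, hL02, hL0⟩ := aux_L (min r r1) Lb (b xhat / 2) C₀ κ₀ (lt_min hr hr1) (by positivity)
  refine ⟨κ₀ + κ₀ ^ 2 / 2 * (2 * b xhat + b xhat * C₀ + Lb + CR) + Lq * κ₀, by positivity,
    exp (-L0), ⟨exp_pos _, exp_lt_exp.2 (by linarith)⟩, ?_⟩
  rintro ε ⟨hε0, hε1⟩
  obtain ⟨L, hL⟩ : ∃ L, L = log (1 / ε) := ⟨_, rfl⟩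
  rw [← hL]
  have hεL : ε = exp (-L) := by
    rw [hL, one_div, log_inv, neg_neg, exp_log hε0]
  have hLL0 : L0 < L := by
    rw [hεL] at hε1
    have := exp_lt_exp.1 hε1
    linarith
  obtain ⟨c1, c2, c3, c4, c5, c6⟩ := hL0 L hLL0
  have hLpos : 0 < L := by linarith
  obtain ⟨ρ, hρ⟩ : ∃ ρ, ρ = ε * L := ⟨_, rfl⟩
  have hρ0 : 0 < ρ := by rw [hρ]; positivity
  have hρL : ρ * L ≤ 1 := by rw [hρ, hεL]; exact c2
  have hρ1 : ρ ≤ 1 / L := by rw [le_div_iff₀ hLpos]; exact hρL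
  have hρr : ρ < r := (hρ1.trans_lt c3).trans_le (min_le_left _ _)
  have hρr1 : ρ < r1 := (hρ1.trans_lt c3).trans_le (min_le_right _ _)
  set B : Set Pt := ball xhat ρ with hB
  have hBm : MeasurableSet B := measurableSet_ball
  have hBr : B ⊆ ball xhat r := ball_subset_ball hρr.le
  have hBD : B ⊆ D := (ball_subset_ball hρr1.le).trans hr1D
  have hLbρ : (Lb:ℝ) * ρ ≤ b xhat / 2 :=
    (mul_le_mul_of_nonneg_left hρ1 Lb.2).trans c4
  have hbB : ∀ x ∈ B, b xhat - Lb * ρ ≤ b x := by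
    intro x hx
    have h1 := hblip.dist_le_mul x (hBr hx) xhat (mem_ball_self hr)
    have h2 : dist x xhat < ρ := hx
    have h3 : (Lb:ℝ) * dist x xhat ≤ Lb * ρ := mul_le_mul_of_nonneg_left h2.le Lb.2
    rw [Real.dist_eq] at h1
    have := neg_abs_le (b x - b xhat)
    linarith
  have hqB : ∀ x ∈ B, q xhat - Lq * ρ ≤ q x := by
    intro x hx
    have h1 := hqlip.dist_le_mul x (hBr hx) xhat (mem_ball_self hr)
    have h2 : dist x xhat < ρ := hx
    have h3 : (Lq:ℝ) * dist x xhat ≤ Lq * ρ := mul_le_mul_of_nonneg_left h2.le Lq.2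
    rw [Real.dist_eq] at h1
    have := neg_abs_le (q x - q xhat)
    linarith
  -- the mass of the ball
  let χ : Pt → ℝ := B.indicator (fun _ => (1:ℝ))
  have hχm : Measurable χ := measurable_const.indicator hBm
  have hχin : ∀ x ∈ B, χ x = 1 := fun x hx => by simp [χ, hx]
  have hχout : ∀ x, x ∉ B → χ x = 0 := fun x hx => by simp [χ, hx]
  have hχ0 : ∀ x, 0 ≤ χ x := fun x => by
    by_cases hx : x ∈ B
    · rw [hχin x hx]; norm_num
    · rw [hχout x hx]
  have hχ1 : ∀ x, χ x ≤ 1 := fun x => by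
    by_cases hx : x ∈ B
    · rw [hχin x hx]
    · rw [hχout x hx]; norm_num
  have hχn : ∀ x, ‖χ x‖ ≤ 1 := fun x => by
    rw [norm_eq_abs, abs_of_nonneg (hχ0 x)]; exact hχ1 x
  obtain ⟨V, hV⟩ : ∃ V, V = ∫ x in D, χ x * b x := ⟨_, rfl⟩
  have iχ : Integrable χ (volume.restrict D) := by
    simpa using (integrable_const (μ := volume.restrict D) (1:ℝ)).mul_bdd (c := 1)
      hχm.aestronglyMeasurable (Eventually.of_forall hχn)
  have iχb : Integrable (fun x => χ x * b x) (volume.restrict D) :=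
    iχ.mul_bdd (c := Cb) hbm hCb'
  have hvol : ∫ x in D, χ x = ρ ^ 2 * π := by
    have : ∫ x in D, χ x = ∫ x in D ∩ B, (1:ℝ) := by
      rw [setIntegral_indicator hBm]
    rw [this, inter_eq_right.2 hBD, setIntegral_const, smul_eq_mul, mul_one, measureReal_def, hB,
      EuclideanSpace.volume_ball_fin_two, ENNReal.toReal_mul, ENNReal.toReal_pow,
      ENNReal.toReal_ofReal hρ0.le, ENNReal.toReal_ofReal pi_pos.le]
  have hVlow : b xhat / 2 * (ρ ^ 2 * π) ≤ V := by
    rw [hV, ← hvol, ← integral_const_mul]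
    refine integral_mono (iχ.const_mul _) iχb fun x => ?_
    by_cases hx : x ∈ B
    · have := hbB x hx
      simp only [hχin x hx]; linarith
    · simp [hχout x hx]
  have hVpos : 0 < V := lt_of_lt_of_le (by positivity) hVlow
  have hVκ : κ₀ * ε ^ 2 * L ≤ V := by
    refine le_trans ?_ hVlow
    have : b xhat / 2 * (ρ ^ 2 * π) = (b xhat / 2 * π * L) * (ε ^ 2 * L) := by rw [hρ]; ring
    rw [this]
    have := mul_le_mul_of_nonneg_right c5 (by positivity : 0 ≤ ε ^ 2 * L)
    linarith
  obtain ⟨δ, hδ⟩ : ∃ δ, δ = 1 / L := ⟨_, rfl⟩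
  have hδ0 : 0 < δ := by rw [hδ]; positivity
  have hδL : δ * L = 1 := by rw [hδ]; field_simp
  have hδ1 : δ ≤ 1 := by
    rw [hδ, div_le_one hLpos]; linarith
  obtain ⟨c, hc⟩ : ∃ c, c = κ₀ * δ / V := ⟨_, rfl⟩
  have hc0 : 0 < c := by rw [hc]; positivity
  have hcV : c * V = κ₀ * δ := by rw [hc]; field_simp
  have hcle : c * ε ^ 2 ≤ δ ^ 2 := by
    rw [hc, div_mul_eq_mul_div, div_le_iff₀ hVpos]
    have := mul_le_mul_of_nonneg_left hVκ (by positivity : 0 ≤ δ ^ 2)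
    have e : δ ^ 2 * (κ₀ * ε ^ 2 * L) = κ₀ * δ * ε ^ 2 * (δ * L) := by ring
    rw [e, hδL] at this
    linarith
  have hε2 : 0 < ε ^ 2 := by positivity
  have hcc : ε ^ 2 / δ * c ≤ δ := by
    rw [div_mul_eq_mul_div, div_le_iff₀ hδ0, mul_comm, ← sq]; exact hcle
  have hmass : ∫ x in D, (c * χ x) * b x = κ₀ * δ := by
    rw [← hcV, hV, ← integral_const_mul]
    simp only [mul_assoc]
  rw [← hδ]
  refine ⟨fun x => c * χ x, ⟨measurable_const.mul hχm, Eventually.of_forall fun x =>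
    ⟨mul_nonneg hc0.le (hχ0 x), ?_⟩, hmass⟩, ?_⟩
  · rw [le_div_iff₀ hε2]
    have h1 : c * χ x ≤ c := mul_le_of_le_one_right hc0.le (hχ1 x)
    have h2 : c * χ x * ε ^ 2 ≤ c * ε ^ 2 := mul_le_mul_of_nonneg_right h1 hε2.le
    have h3 : δ ^ 2 ≤ δ := by
      rw [sq]; exact mul_le_of_le_one_right hδ0.le hδ1
    have h4 : δ ≤ Λ * δ := le_mul_of_one_le_left hδ0.le hΛ
    exact h2.trans (hcle.trans (h3.trans h4))
  -- the three pieces of the energy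
  obtain ⟨A2, hA2⟩ : ∃ A2, A2 = (1 / (2 * π)) * (L - log 2 - log L) - C₀ := ⟨_, rfl⟩
  rw [← hA2] at c6
  have hlog : log (1 / (2 * ρ)) = L - log 2 - log L := by
    rw [one_div, log_inv, log_mul two_ne_zero hρ0.ne', hρ, log_mul hε0.ne' hLpos.ne', hεL, log_exp]
    ring
  have hGB : ∀ᵐ p ∂((volume.restrict D).prod (volume.restrict D)),
      p.1 ∈ B → p.2 ∈ B → A2 ≤ G p.1 p.2 := by
    rw [Measure.prod_restrict] at hGlow
    have h1 := (ae_restrict_iff' (measurableSet_ball.prod measurableSet_ball)).1 hGlow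
    have h2 : ∀ᵐ p ∂((volume.restrict D).prod (volume.restrict D)),
        p ∈ ball xhat r ×ˢ ball xhat r →
          (1 / (2 * π)) * log (1 / dist p.1 p.2) - C₀ ≤ G p.1 p.2 := by
      rw [Measure.prod_restrict]; exact ae_restrict_of_ae h1
    filter_upwards [h2, aux_offdiag D] with p h2 h3 hp1 hp2
    refine le_trans ?_ (h2 ⟨hBr hp1, hBr hp2⟩)
    have hd : 0 < dist p.1 p.2 := dist_pos.2 h3
    have hd2 : dist p.1 p.2 ≤ 2 * ρ := by
      have := dist_triangle_right p.1 p.2 xhat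
      have a1 : dist p.1 xhat < ρ := hp1
      have a2 : dist p.2 xhat < ρ := hp2
      linarith
    have h4 : log (1 / (2 * ρ)) ≤ log (1 / dist p.1 p.2) :=
      log_le_log (by positivity) (one_div_le_one_div_of_le hd hd2)
    rw [hlog] at h4
    have := mul_le_mul_of_nonneg_left h4 (by positivity : 0 ≤ 1 / (2 * π))
    rw [hA2]; linarith
  have hA1 : 0 ≤ b xhat - Lb * ρ := by linarith
  have hK := aux_energy (volume.restrict D) b hbm Cb hCb' G hGi R hRi (fun x => c * χ x)
    (measurable_const.mul hχm) c (fun x => by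
      rw [norm_mul, norm_eq_abs, abs_of_pos hc0]
      exact mul_le_of_le_one_right hc0.le (hχn x))
    ((b xhat - Lb * ρ) * A2 - CR) (by
      filter_upwards [hGB] with p hp
      by_cases h1 : p.1 ∈ B
      · by_cases h2 : p.2 ∈ B
        · have hG' := hp h1 h2
          have hb1 := hbB _ h1
          have hb1p := hbpos _ (hBD h1)
          have hb2p := hbpos _ (hBD h2)
          refine mul_le_mul_of_nonneg_right ?_ ?_
          · have := mul_le_mul hb1 hG' c6 hb1p.le
            have := (abs_le.1 (hCR p.1 p.2)).1
            linarith
          · simp only [hχin _ h1, hχin _ h2]; positivity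
        · simp [hχout _ h2]
      · simp [hχout _ h1])
  rw [hmass] at hK
  have hQ : (q xhat - Lq * ρ) * (κ₀ * δ) ≤ ∫ x in D, q x * (c * χ x) * b x := by
    rw [← hmass, ← integral_const_mul]
    have i1 : Integrable (fun x => (c * χ x) * b x) (volume.restrict D) := by
      simpa only [mul_assoc] using iχb.const_mul c
    have i2 : Integrable (fun x => q x * (c * χ x) * b x) (volume.restrict D) := by
      simpa only [mul_assoc] using i1.bdd_mul (c := Cq) hqm hCq'
    refine integral_mono (i1.const_mul _) i2 fun x => ?_
    by_cases hx : x ∈ B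
    · have h1 := hqB x hx
      have h2 := hbpos x (hBD hx)
      simp only [hχin x hx]
      have := mul_le_mul_of_nonneg_right h1 (by positivity : 0 ≤ c * 1 * b x)
      linarith
    · simp [hχout x hx]
  have hF : (δ / ε ^ 2) * ∫ x in D, Fstar finv ((ε ^ 2 / δ) * (c * χ x)) * b x
      ≤ κ₀ * δ * finv δ := by
    have e : ∀ x, Fstar finv ((ε ^ 2 / δ) * (c * χ x)) * b x =
        (Fstar finv (ε ^ 2 / δ * c)) * (χ x * b x) := by
      intro x
      by_cases hx : x ∈ B
      · simp [hχin x hx]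
      · simp [hχout x hx, Fstar]
    simp only [e]
    rw [integral_const_mul, ← hV]
    have h1 : Fstar finv (ε ^ 2 / δ * c) ≤ (ε ^ 2 / δ * c) * finv δ :=
      aux_Fstar finv hfim _ _ (by positivity) hcc
    have h2 := mul_le_mul_of_nonneg_left h1 (by positivity : 0 ≤ δ / ε ^ 2 * V)
    have h3 : δ / ε ^ 2 * V * ((ε ^ 2 / δ * c) * finv δ) = (c * V) * finv δ := by
      field_simp
    rw [h3, hcV] at h2
    linarith
  have hE : (1 / 2) * (((b xhat - Lb * ρ) * A2 - CR) * (κ₀ * δ) ^ 2)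
      + (q xhat - Lq * ρ) * (κ₀ * δ) - κ₀ * δ * finv δ ≤
      Efun D b q G R finv ε δ (fun x => c * χ x) := by
    unfold Efun Kop
    linarith
  refine le_trans ?_ hE
  -- final arithmetic
  obtain ⟨l, hl⟩ : ∃ l, l = log L := ⟨_, rfl⟩
  rw [← hl] at c1 hA2 ⊢
  have hlL : l / L = l * δ := by rw [hδ]; ring
  rw [hlL]
  exact aux_arith κ₀ (b xhat) (q xhat) Lb Lq ρ A2 CR δ L l C₀ (finv δ) hκ hbh Lb.2 Lq.2 hρ0.le hρL
    hδ0 hδL hLpos c1 hC₀ hCR0 (hfin δ) c6 hA2
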